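/- Let l, s, m_1, ..., m_s, r_1, ..., r_{s+1} be positive integers with r_1 | r_2 | ... | r_{s+1}. Define A = {r_1 j_1 + m_1 r_2 j_2 + ... + m_1···m_{s−1} r_s j_s + m_1···m_s r_{s+1} j_{s+1} : 0 ≤ j_i ≤ m_i − 1 for i ≤ s, 0 ≤ j_{s+1} ≤ l − 1} and B = (r_1ℕ \ m_1 r_1ℕ) ∪ (m_1 r_2ℕ \ m_1 m_2 r_2ℕ) ∪ ... ∪ (m_1···m_{s−1} r_sℕ \ m_1···m_s r_sℕ) ∪ (m_1···m_s r_{s+1}ℕ \ m_1···m_s r_{s+1} lℕ). Then for all n, P(A; n) = Q(B; n). -/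

import Mathlib

open scoped Classical

/-- Number of partitions of `n` whose part multiplicities all lie in `A`. -/
noncomputable def partP (A : Set ℕ) (n : ℕ) : ℕ :=
  (Finset.univ.filter (fun p : Nat.Partition n =>
    ∀ i ∈ p.parts, Multiset.count i p.parts ∈ A)).card

/-- Number of partitions of `n` whose parts all lie in `B`. -/
noncomputable def partQ (B : Set ℕ) (n : ℕ) : ℕ :=
  (Finset.univ.filter (fun p : Nat.Partition n => ∀ i ∈ p.parts, i ∈ B)).card

/-- The coefficient `m₁⋯m_{i-1} rᵢ` in the mixed-radix construction. -/
def mixCoef (s : ℕ) (m : Fin s → ℕ) (r : Fin (s + 1) → ℕ) (i : Fin (s + 1)) : ℕ :=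
  (∏ t ∈ Finset.univ.filter (fun t : Fin s => (t : ℕ) < (i : ℕ)), m t) * r i

section MixedRadix

open PowerSeries PowerSeries.WithPiTopology Finset

/-- The mixed-radix digit expansions form a finset whose generating polynomial factors. -/
theorem exists_finset_mixed_radix {R : Type*} [CommSemiring R] (N : ℕ) (c M : Fin N → ℕ)
    (hc : ∀ i, 0 < c i) (hM : ∀ i, 0 < M i) (h : ∀ i j, i < j → c i * M i ∣ c j) :
    ∃ S : Finset ℕ,
      (∀ x, x ∈ S ↔ ∃ j : Fin N → ℕ, (∀ i, j i < M i) ∧ x = ∑ i, c i * j i) ∧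
      (∀ y : R, ∑ a ∈ S, y ^ a = ∏ i, ∑ j ∈ range (M i), (y ^ c i) ^ j) ∧
      ∀ K, 0 < K → (∀ i, c i * M i ∣ K) → ∀ x ∈ S, x < K := by
  induction N with
  | zero =>
    refine ⟨{0}, fun x ↦ ?_, fun y ↦ by simp, fun K hK _ x hx ↦ ?_⟩
    · simp
    · rw [mem_singleton.mp hx]; exact hK
  | succ N ih =>
    obtain ⟨S, hS, hprod, hlt⟩ := ih (fun i ↦ c i.castSucc) (fun i ↦ M i.castSucc)
      (fun _ ↦ hc _) (fun _ ↦ hM _) (fun i j hij ↦ h _ _ (by simpa using hij))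
    have hlast : ∀ x ∈ S, x < c (Fin.last N) :=
      hlt _ (hc _) fun i ↦ h _ _ (Fin.castSucc_lt_last i)
    have hinj : Set.InjOn (fun p : ℕ × ℕ ↦ p.1 + c (Fin.last N) * p.2)
        (S ×ˢ range (M (Fin.last N)) : Finset (ℕ × ℕ)) := by
      rintro ⟨a, b⟩ hab ⟨a', b'⟩ hab' heq
      simp only [coe_product, Set.mem_prod, mem_coe] at hab hab' heq
      have h1 := congrArg (· % c (Fin.last N)) heq
      have h2 := congrArg (· / c (Fin.last N)) heq
      simp only [Nat.add_mul_mod_self_left, Nat.mod_eq_of_lt (hlast _ hab.1),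
        Nat.mod_eq_of_lt (hlast _ hab'.1)] at h1
      simp only [Nat.add_mul_div_left _ _ (hc _), Nat.div_eq_of_lt (hlast _ hab.1),
        Nat.div_eq_of_lt (hlast _ hab'.1), zero_add] at h2
      rw [h1, h2]
    refine ⟨(S ×ˢ range (M (Fin.last N))).image fun p ↦ p.1 + c (Fin.last N) * p.2,
      fun x ↦ ?_, fun y ↦ ?_, fun K hK hdvd x hx ↦ ?_⟩
    · simp only [mem_image, mem_product, mem_range, Prod.exists, hS]
      constructor
      · rintro ⟨a, b, ⟨⟨j, hj, rfl⟩, hb⟩, rfl⟩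
        refine ⟨Fin.snoc j b, fun i ↦ ?_, ?_⟩
        · refine Fin.lastCases ?_ (fun i ↦ ?_) i
          · simpa using hb
          · simpa using hj i
        · simp [Fin.sum_univ_castSucc]
      · rintro ⟨j, hj, rfl⟩
        exact ⟨_, j (Fin.last N), ⟨⟨fun i ↦ j i.castSucc, fun i ↦ hj _, rfl⟩, hj _⟩,
          (Fin.sum_univ_castSucc fun i ↦ c i * j i).symm⟩
    · rw [sum_image hinj, sum_product, Fin.prod_univ_castSucc, ← hprod, sum_mul_sum]
      simp_rw [pow_add, pow_mul]
    · simp only [mem_image, mem_product, mem_range, Prod.exists] at hx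
      obtain ⟨a, b, ⟨ha, hb⟩, rfl⟩ := hx
      have h1 := hlast a ha
      have h2 := Nat.le_of_dvd hK (hdvd (Fin.last N))
      have h3 := Nat.mul_le_mul_left (c (Fin.last N)) (Nat.succ_le_of_lt hb)
      rw [Nat.succ_eq_add_one, mul_add, mul_one] at h3
      omega

section GeneratingFunctions

variable {R : Type*} [CommRing R] [TopologicalSpace R]

theorem multipliable_one_sub_X_pow_mul [IsTopologicalRing R] [T2Space R] {d : ℕ} (hd : 0 < d) :
    Multipliable fun k : ℕ ↦ (1 - X ^ ((k + 1) * d) : R⟦X⟧) := by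
  simp_rw [sub_eq_add_neg]
  apply multipliable_one_add_of_tendsto_order_atTop_nhds_top
  refine ENat.tendsto_nhds_top_iff_natCast_lt.mpr fun n ↦ Filter.eventually_atTop.mpr ⟨n, ?_⟩
  intro k hk
  nontriviality R using Subsingleton.eq_zero (α := R⟦X⟧)
  rw [order_neg, order_X_pow]
  have : n < (k + 1) * d := by nlinarith
  exact_mod_cast this

theorem constantCoeff_of_hasProd_one_sub_X_pow_mul [T2Space R] {d : ℕ} (hd : 0 < d) {t : R⟦X⟧}
    (ht : HasProd (fun k : ℕ ↦ (1 - X ^ ((k + 1) * d) : R⟦X⟧)) t) : constantCoeff t = 1 := by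
  have h := ht.map (constantCoeff (R := R)) (continuous_constantCoeff R)
  have h1 : (constantCoeff (R := R)) ∘ (fun k : ℕ ↦ (1 - X ^ ((k + 1) * d) : R⟦X⟧)) =
      fun _ ↦ 1 := by
    funext k
    simp [hd.ne']
  rw [h1] at h
  exact h.unique hasProd_one

theorem hasProd_ite_dvd_one_sub_X_pow {d : ℕ} (hd : 0 < d) {t : R⟦X⟧}
    (ht : HasProd (fun k : ℕ ↦ (1 - X ^ ((k + 1) * d) : R⟦X⟧)) t) :
    HasProd (fun k : ℕ ↦ if d ∣ k + 1 then (1 - X ^ (k + 1) : R⟦X⟧) else 1) t := by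
  have hpos (k : ℕ) : (k + 1) * d - 1 + 1 = (k + 1) * d := Nat.sub_add_cancel (by nlinarith)
  have hinj : Function.Injective fun k : ℕ ↦ (k + 1) * d - 1 := by
    intro a b hab
    have h : (a + 1) * d = (b + 1) * d := by rw [← hpos a, ← hpos b]; simpa using hab
    simpa using Nat.eq_of_mul_eq_mul_right hd h
  rw [← hinj.hasProd_iff]
  · convert ht using 2 with k
    simp [hpos]
  · intro k hk
    rw [if_neg]
    rintro ⟨e, he⟩
    refine hk ⟨e - 1, ?_⟩
    have : 0 < e := Nat.pos_of_ne_zero (by rintro rfl; simp at he)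
    simp only [Nat.sub_add_cancel this]
    rw [mul_comm, ← he, Nat.add_sub_cancel]

theorem hasProd_mk_partP [T2Space R] (A : Set ℕ) (S : Finset ℕ) (hS : ∀ x, x ∈ S ↔ x ∈ A)
    (h0 : 0 ∈ S) :
    HasProd (fun k : ℕ ↦ ∑ a ∈ S, ((X : R⟦X⟧) ^ (k + 1)) ^ a)
      (PowerSeries.mk fun n ↦ (partP A n : R)) := by
  convert! Nat.Partition.hasProd_genFun (fun _ c ↦ if c ∈ A then (1 : R) else 0) using 1
  · ext1 k
    have hsub : S.erase 0 = ((S.erase 0).image (· - 1)).image (· + 1) := by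
      ext x
      simp only [mem_image, mem_erase]
      constructor
      · rintro ⟨hx, hxS⟩
        exact ⟨x - 1, ⟨x, ⟨hx, hxS⟩, rfl⟩, by omega⟩
      · rintro ⟨_, ⟨y, ⟨hy, hyS⟩, rfl⟩, rfl⟩
        rw [Nat.sub_add_cancel (Nat.pos_of_ne_zero hy)]
        exact ⟨hy, hyS⟩
    rw [← add_sum_erase _ _ h0, pow_zero, tsum_eq_sum (s := (S.erase 0).image (· - 1))]
    · congr 1
      rw [hsub, sum_image (by simp), ← hsub]
      refine sum_congr rfl fun b hb ↦ ?_
      have : b + 1 ∈ A := by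
        rw [← hS]
        have h1 := mem_image_of_mem (· + 1) hb
        rw [← hsub] at h1
        exact mem_of_mem_erase h1
      simp [this, pow_mul]
    · intro b hb
      have : b + 1 ∉ A := by
        rw [← hS]
        exact fun h ↦ hb (mem_image.mpr ⟨b + 1, by simp [h], rfl⟩)
      simp [this]
  · simp_rw [Nat.Partition.genFun, partP, card_filter, Finsupp.prod, prod_boole]
    simp

theorem hasProd_mk_partQ [IsTopologicalRing R] [T2Space R] (B : Set ℕ) :
    HasProd (fun k : ℕ ↦ if k + 1 ∈ B then ∑' j : ℕ, (X : R⟦X⟧) ^ ((k + 1) * j) else 1)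
      (PowerSeries.mk fun n ↦ (partQ B n : R)) := by
  convert! Nat.Partition.hasProd_powerSeriesMk_card_restricted R (· ∈ B) using 1

end GeneratingFunctions

theorem ite_mul_prod_ite_dvd {R ι : Type*} [CommMonoid R] [Fintype ι] [LinearOrder ι]
    (c M : ι → ℕ) (h : ∀ i j, i < j → c i * M i ∣ c j) (n : ℕ) (q y : R) (hq : q * y = 1) :
    (if ∃ i, c i ∣ n ∧ ¬ c i * M i ∣ n then q else 1) * ∏ i, (if c i ∣ n then y else 1) =
      ∏ i, if c i * M i ∣ n then y else 1 := by
  split_ifs with hex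
  · obtain ⟨i, hi, hi'⟩ := hex
    rw [← mul_prod_erase univ _ (mem_univ i), ← mul_prod_erase univ (fun i ↦ if c i * M i ∣ n
      then y else 1) (mem_univ i), if_pos hi, if_neg hi', ← mul_assoc, hq]
    congr 1
    refine prod_congr rfl fun k hk ↦ if_congr ?_ rfl rfl
    refine ⟨fun hkn ↦ ?_, fun hkn ↦ (dvd_mul_right _ _).trans hkn⟩
    rcases lt_or_gt_of_ne (ne_of_mem_erase hk) with hlt | hlt
    · exact (h _ _ hlt).trans hi
    · exact absurd ((h _ _ hlt).trans hkn) hi'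
  · push Not at hex
    rw [one_mul]
    exact prod_congr rfl fun k _ ↦ if_congr
      ⟨hex k, fun hkn ↦ (dvd_mul_right _ _).trans hkn⟩ rfl rfl

theorem partP_eq_partQ_of_dvd_chain (N : ℕ) (c M : Fin N → ℕ)
    (hc : ∀ i, 0 < c i) (hM : ∀ i, 0 < M i) (h : ∀ i j, i < j → c i * M i ∣ c j) (n : ℕ) :
    partP {x | ∃ j : Fin N → ℕ, (∀ i, j i < M i) ∧ x = ∑ i, c i * j i} n =
      partQ {x | ∃ i, c i ∣ x ∧ ¬ c i * M i ∣ x} n := by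
  obtain ⟨S, hS, hprod, -⟩ := exists_finset_mixed_radix (R := ℤ⟦X⟧) N c M hc hM h
  have hcM (i) : 0 < c i * M i := Nat.mul_pos (hc i) (hM i)
  have h0 : 0 ∈ S := (hS 0).mpr ⟨0, by simpa using hM, by simp⟩
  have hP := hasProd_mk_partP (R := ℤ)
    {x | ∃ j : Fin N → ℕ, (∀ i, j i < M i) ∧ x = ∑ i, c i * j i} S hS h0
  have hQ := hasProd_mk_partQ (R := ℤ) {x | ∃ i, c i ∣ x ∧ ¬ c i * M i ∣ x}
  have ht {d : ℕ} (hd : 0 < d) := (multipliable_one_sub_X_pow_mul (R := ℤ) hd).hasProd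
  have hu := hasProd_prod (s := univ) fun i _ ↦ ht (hc i)
  have hv := hasProd_prod (s := univ) fun i _ ↦ ht (hcM i)
  have hu' := hasProd_prod (s := univ) fun i _ ↦ hasProd_ite_dvd_one_sub_X_pow (hc i) (ht (hc i))
  have hv' := hasProd_prod (s := univ) fun i _ ↦
    hasProd_ite_dvd_one_sub_X_pow (hcM i) (ht (hcM i))
  have h1 := (hP.mul hu).unique (hv.congr_fun ?_)
  have h2 := (hQ.mul hu').unique (hv'.congr_fun ?_)
  · have hne : (∏ i, ∏' k : ℕ, (1 - X ^ ((k + 1) * c i) : ℤ⟦X⟧)) ≠ 0 :=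
      prod_ne_zero_iff.mpr fun i _ h0 ↦ by
        have := constantCoeff_of_hasProd_one_sub_X_pow_mul (hc i) (ht (hc i))
        simp [h0] at this
    simpa using PowerSeries.ext_iff.mp (mul_right_cancel₀ hne (h1.trans h2.symm)) n
  · intro k
    convert! ite_mul_prod_ite_dvd c M h (k + 1) (∑' j : ℕ, (X : ℤ⟦X⟧) ^ ((k + 1) * j))
      (1 - X ^ (k + 1)) ?_
    simp_rw [pow_mul]
    exact tsum_pow_mul_one_sub_of_constantCoeff_eq_zero (by simp)
  · intro k
    rw [hprod, ← prod_mul_distrib]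
    refine prod_congr rfl fun i _ ↦ ?_
    rw [← pow_mul, ← mul_assoc, pow_mul _ (_ * _) (M i), geom_sum_mul_neg]

theorem mixCoef_pos {s : ℕ} {m : Fin s → ℕ} {r : Fin (s + 1) → ℕ}
    (hm : ∀ i, 0 < m i) (hr : ∀ i, 0 < r i) (i : Fin (s + 1)) : 0 < mixCoef s m r i :=
  Nat.mul_pos (prod_pos fun t _ ↦ hm t) (hr i)

theorem mixCoef_mul_dvd {s : ℕ} {m : Fin s → ℕ} {r : Fin (s + 1) → ℕ}
    (hchain : ∀ i : Fin s, r i.castSucc ∣ r i.succ) (i : Fin s) (j : Fin (s + 1))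
    (hij : i.castSucc < j) : mixCoef s m r i.castSucc * m i ∣ mixCoef s m r j := by
  have hmono : r i.castSucc ∣ r j := by
    induction j using Fin.induction with
    | zero => simp at hij
    | succ k ih =>
      rcases (Fin.le_castSucc_iff.mpr hij).lt_or_eq with hlt | heq
      · exact (ih hlt).trans (hchain k)
      · rw [heq]; exact hchain k
  unfold mixCoef
  rw [mul_right_comm]
  refine mul_dvd_mul ?_ hmono
  rw [mul_comm, ← prod_insert (by simp)]
  refine prod_dvd_prod_of_subset _ _ _ fun t ht ↦ ?_
  have hij' : (i : ℕ) < j := hij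
  simp only [mem_insert, mem_filter, mem_univ, true_and, Fin.val_castSucc] at ht ⊢
  rcases ht with rfl | ht
  · exact hij'
  · exact ht.trans hij'

end MixedRadix

/-- Mixed-radix partition theorem. -/
theorem mixed_radix_partition (l s : ℕ) (hl : 0 < l) (hs : 0 < s)
    (m : Fin s → ℕ) (r : Fin (s + 1) → ℕ)
    (hm : ∀ i, 0 < m i) (hr : ∀ i, 0 < r i)
    (hchain : ∀ i : Fin s, r i.castSucc ∣ r i.succ) (n : ℕ) :
    partP {x | ∃ j : Fin (s + 1) → ℕ,
        (∀ i : Fin s, j i.castSucc ≤ m i - 1) ∧ j (Fin.last s) ≤ l - 1 ∧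
        x = ∑ i, mixCoef s m r i * j i} n
      = partQ ((⋃ i : Fin s,
          {x | 0 < x ∧ mixCoef s m r i.castSucc ∣ x ∧ ¬ mixCoef s m r i.castSucc * m i ∣ x})
        ∪ {x | 0 < x ∧ mixCoef s m r (Fin.last s) ∣ x ∧
            ¬ mixCoef s m r (Fin.last s) * l ∣ x}) n := by
  have key := partP_eq_partQ_of_dvd_chain (s + 1) (mixCoef s m r)
    (Fin.snoc (α := fun _ ↦ ℕ) m l) (mixCoef_pos hm hr)
    (fun i ↦ Fin.lastCases (by simpa using hl) (fun i ↦ by simpa using hm i) i)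
    (fun i ↦ Fin.lastCases (fun j hj ↦ absurd hj (Fin.le_last j).not_gt)
      (fun i j hij ↦ by simpa using mixCoef_mul_dvd hchain i j hij) i) n
  convert key using 2
  · ext x
    have hm' (i : Fin s) (a : ℕ) : a ≤ m i - 1 ↔ a < m i := Nat.le_sub_one_iff_lt (hm i)
    simp only [Set.mem_ofPred_eq, Fin.forall_fin_succ', Fin.snoc_castSucc, Fin.snoc_last,
      Nat.le_sub_one_iff_lt hl, hm', and_assoc]
  · ext x
    have hpos (d : ℕ) : ¬ d ∣ x → 0 < x := fun h ↦
      Nat.pos_of_ne_zero (by rintro rfl; exact h (dvd_zero d))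
    simp only [Set.mem_union, Set.mem_iUnion, Set.mem_ofPred_eq, Fin.exists_fin_succ',
      Fin.snoc_castSucc, Fin.snoc_last]
    exact or_congr (exists_congr fun i ↦ and_iff_right_of_imp fun h ↦ hpos _ h.2)
      (and_iff_right_of_imp fun h ↦ hpos _ h.2)
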